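/- arXiv:2602.23919 — 2 statements merged into one kernel-verified Lean document; each statement's English description precedes it below -/
import Mathlib

section
/- (Cutoff functions with R-uniform derivative bounds.) Let D_λ(x) = (λ^{σ_1}x_1, …, λ^{σ_N}x_N) be anisotropic dilations on ℝ^N, ‖x‖ = (∑_{i=1}^N |x_i|^{2σ_N!/σ_i})^{1/(2σ_N!)} the smooth homogeneous norm, and let Y_1, …, Y_m be smooth vector fields on ℝ^N that are 1-homogeneous (Y_i(u∘D_λ) = λ(Y_iu)∘D_λ for every smooth u). Then for every positive integer h there exists a constant c_h > 0 such that for every R ≥ 1 there exists a radial function φ_R ∈ C^∞(ℝ^N; [0,1]) (i.e. φ_R(x) depends only on ‖x‖) with φ_R ≡ 1 on {‖x‖ ≤ R}, φ_R ≡ 0 on {‖x‖ ≥ 2R}, and ‖Y_Iφ_R‖_{L^∞(ℝ^N)} ≤ c_h for every multi-index I with entries in {1,…,m} and |I| ≤ h; in particular c_h does not depend on R. -/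
open MeasureTheory

noncomputable section

variable {E : Type*} [NormedAddCommGroup E] [NormedSpace ℝ E]

/-- Derivative of `u` along the vector field `Y` at `x`. -/
def vfDeriv (Y : E → E) (u : E → ℝ) (x : E) : ℝ := lineDeriv ℝ u x (Y x)

/-- Iterated derivative along a list of vector fields. -/
def vfIter {m : ℕ} (Y : Fin m → E → E) : List (Fin m) → (E → ℝ) → E → ℝ
  | [], u => u
  | i :: l, u => vfDeriv (Y i) (vfIter Y l u)

/-- Lie bracket of two vector fields. -/
def vfLie (Y Z : E → E) (x : E) : E := fderiv ℝ Z x (Y x) - fderiv ℝ Y x (Z x)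

/-- Iterated Lie bracket along a nonempty list of indices. -/
def vfIterLie {m : ℕ} (Y : Fin m → E → E) : List (Fin m) → E → E
  | [] => fun _ => 0
  | [i] => Y i
  | i :: j :: l => vfLie (Y i) (vfIterLie Y (j :: l))

/-- Hörmander's condition: the iterated Lie brackets span the space at every point. -/
def HormanderCond {m : ℕ} (Y : Fin m → E → E) : Prop :=
  ∀ x : E,
    Submodule.span ℝ {v : E | ∃ l : List (Fin m), l ≠ [] ∧ v = vfIterLie Y l x} = ⊤

/-- Carnot–Carathéodory control distance induced by the vector fields `Y`. -/
def controlDist {m : ℕ} (Y : Fin m → E → E) (x y : E) : ℝ :=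
  sInf {δ : ℝ | 0 < δ ∧ ∃ γ : ℝ → E, ∃ c : Fin m → ℝ → ℝ, ∃ K : NNReal,
    LipschitzOnWith K γ (Set.Icc 0 1) ∧ γ 0 = x ∧ γ 1 = y ∧
    (∀ᵐ t ∂(volume.restrict (Set.Ioo (0:ℝ) 1)),
      HasDerivAt γ (∑ i, c i t • Y i (γ t)) t) ∧
    (∀ i, ∀ t ∈ Set.Icc (0:ℝ) 1, |c i t| < δ)}

def supBoundOn (Ω : Set E) (u : E → ℝ) (C : ℝ) : Prop := ∀ x ∈ Ω, |u x| ≤ C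

/-- Sup norm of `u` on `Ω`. -/
def supNormOn (Ω : Set E) (u : E → ℝ) : ℝ := sInf {C : ℝ | 0 ≤ C ∧ supBoundOn Ω u C}

def holderBoundOn (d : E → E → ℝ) (α : ℝ) (Ω : Set E) (u : E → ℝ) (C : ℝ) : Prop :=
  ∀ x ∈ Ω, ∀ y ∈ Ω, |u x - u y| ≤ C * d x y ^ α

/-- Hölder seminorm of `u` on `Ω` w.r.t. the distance `d`. -/
def holderSemi (d : E → E → ℝ) (α : ℝ) (Ω : Set E) (u : E → ℝ) : ℝ :=
  sInf {C : ℝ | 0 ≤ C ∧ holderBoundOn d α Ω u C}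

/-- Hölder norm of `u` on `Ω`. -/
def holderNorm (d : E → E → ℝ) (α : ℝ) (Ω : Set E) (u : E → ℝ) : ℝ :=
  supNormOn Ω u + holderSemi d α Ω u

/-- `u ∈ C^α(Ω)`: `u` is bounded and Hölder continuous on `Ω`. -/
def MemCalpha (d : E → E → ℝ) (α : ℝ) (Ω : Set E) (u : E → ℝ) : Prop :=
  (∃ C, 0 ≤ C ∧ supBoundOn Ω u C) ∧ ∃ C, 0 ≤ C ∧ holderBoundOn d α Ω u C

/-- `u ∈ C^{k,α}(Ω)`: all derivatives along the fields `Y` up to order `k`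
exist pointwise on `Ω` and belong to `C^α(Ω)`. -/
def MemCkAlpha {m : ℕ} (Y : Fin m → E → E) (d : E → E → ℝ) (α : ℝ) (k : ℕ)
    (Ω : Set E) (u : E → ℝ) : Prop :=
  (∀ l : List (Fin m), l.length ≤ k → MemCalpha d α Ω (vfIter Y l u)) ∧
  ∀ l : List (Fin m), l.length < k → ∀ i : Fin m, ∀ x ∈ Ω,
    LineDifferentiableAt ℝ (vfIter Y l u) x (Y i x)

/-- The `C^{k,α}(Ω)` norm: sum of the `C^α` norms of all derivatives up to order `k`. -/
def ckNorm {m : ℕ} (Y : Fin m → E → E) (d : E → E → ℝ) (α : ℝ) (k : ℕ)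
    (Ω : Set E) (u : E → ℝ) : ℝ :=
  ∑ j ∈ Finset.range (k + 1), ∑ f : Fin j → Fin m,
    holderNorm d α Ω (vfIter Y (List.ofFn f) u)

/-- Symmetric, uniformly positive-definite coefficient matrix with ellipticity constant `Λ`. -/
def EllipticSym {m : ℕ} (a : Fin m → Fin m → E → ℝ) (Λ : ℝ) : Prop :=
  ∀ x : E, (∀ i j, a i j x = a j i x) ∧
    ∀ ξ : Fin m → ℝ,
      Λ * (∑ i, ξ i ^ 2) ≤ (∑ i, ∑ j, a i j x * ξ i * ξ j) ∧
      (∑ i, ∑ j, a i j x * ξ i * ξ j) ≤ Λ⁻¹ * (∑ i, ξ i ^ 2)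

/-- The operator `L u = ∑_{i,j} a_{ij}(x) Y_i Y_j u`. -/
def opL {m : ℕ} (Y : Fin m → E → E) (a : Fin m → Fin m → E → ℝ) (u : E → ℝ) (x : E) : ℝ :=
  ∑ i, ∑ j, a i j x * vfIter Y [i, j] u x

/-- The frozen operator `L_{x̄} u = ∑_{i,j} a_{ij}(x̄) Y_i Y_j u`. -/
def opLFrozen {m : ℕ} (Y : Fin m → E → E) (a : Fin m → Fin m → E → ℝ) (xb : E)
    (u : E → ℝ) (x : E) : ℝ :=
  ∑ i, ∑ j, a i j xb * vfIter Y [i, j] u x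

/-- Anisotropic dilations `D_λ(x)_i = λ^{σ_i} x_i`. -/
def dil {N : ℕ} (σ : Fin N → ℕ) (l : ℝ) (x : Fin N → ℝ) : Fin N → ℝ :=
  fun i => l ^ (σ i) * x i

/-- A vector field `Y` is homogeneous of degree `s` with respect to the dilations `dil σ`. -/
def IsHomogeneousVF {N : ℕ} (σ : Fin N → ℕ) (Y : (Fin N → ℝ) → (Fin N → ℝ)) (s : ℝ) : Prop :=
  ∀ u : (Fin N → ℝ) → ℝ, ContDiff ℝ (⊤ : ℕ∞) u → ∀ l : ℝ, 0 < l → ∀ x,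
    vfDeriv Y (fun w => u (dil σ l w)) x = l ^ s * vfDeriv Y u (dil σ l x)

/-- Smooth homogeneous norm `‖x‖ = (∑ |x_i|^{2σ_N!/σ_i})^{1/(2σ_N!)}`. -/
def homNorm {N : ℕ} (σ : Fin N → ℕ) (x : Fin N → ℝ) : ℝ :=
  (∑ i, |x i| ^ ((2 * Nat.factorial (Finset.univ.sup σ)) / σ i)) ^
    ((1 : ℝ) / (2 * (Nat.factorial (Finset.univ.sup σ) : ℝ)))

/-- Left-invariance of a vector field with respect to the group operation `mul`. -/
def LeftInvariantVF (mul : E → E → E) (Y : E → E) : Prop :=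
  ∀ z : E, ∀ u : E → ℝ, ContDiff ℝ (⊤ : ℕ∞) u → ∀ x,
    vfDeriv Y (fun w => u (mul z w)) x = vfDeriv Y u (mul z x)



lemma vfDeriv_eq {u : E → ℝ} (hu : ContDiff ℝ (⊤ : ℕ∞) u) (Y : E → E) :
    vfDeriv Y u = fun x => fderiv ℝ u x (Y x) := by
  funext x
  exact ((hu.differentiable (by simp)) x).lineDeriv_eq_fderiv

lemma vfDeriv_contDiff {u : E → ℝ} (hu : ContDiff ℝ (⊤ : ℕ∞) u) {Y : E → E}
    (hY : ContDiff ℝ (⊤ : ℕ∞) Y) : ContDiff ℝ (⊤ : ℕ∞) (vfDeriv Y u) := by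
  rw [vfDeriv_eq hu]
  exact (hu.fderiv_right (m := (⊤ : ℕ∞)) (by simp)).clm_apply hY

lemma vfDeriv_compact {u : E → ℝ} (hu : ContDiff ℝ (⊤ : ℕ∞) u) (hc : HasCompactSupport u)
    (Y : E → E) : HasCompactSupport (vfDeriv Y u) := by
  rw [vfDeriv_eq hu]
  refine (hc.fderiv (𝕜 := ℝ)).mono ?_
  intro x hx
  simp only [Function.mem_support] at hx ⊢
  intro h0
  exact hx (by rw [h0]; simp)

lemma vfIter_nice {m : ℕ} {Y : Fin m → E → E} (hY : ∀ i, ContDiff ℝ (⊤ : ℕ∞) (Y i))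
    {u : E → ℝ} (hu : ContDiff ℝ (⊤ : ℕ∞) u) (hc : HasCompactSupport u) (l : List (Fin m)) :
    ContDiff ℝ (⊤ : ℕ∞) (vfIter Y l u) ∧ HasCompactSupport (vfIter Y l u) := by
  induction l with
  | nil => exact ⟨hu, hc⟩
  | cons i l ih => exact ⟨vfDeriv_contDiff ih.1 (hY i), vfDeriv_compact ih.1 ih.2 _⟩

lemma dil_contDiff {N : ℕ} (σ : Fin N → ℕ) (r : ℝ) : ContDiff ℝ (⊤ : ℕ∞) (dil σ r) := by
  unfold dil
  fun_prop

lemma vfIter_dil {N m : ℕ} (σ : Fin N → ℕ) {Y : Fin m → (Fin N → ℝ) → (Fin N → ℝ)}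
    (hY : ∀ i, ContDiff ℝ (⊤ : ℕ∞) (Y i)) (hY_hom : ∀ i, IsHomogeneousVF σ (Y i) 1)
    {u : (Fin N → ℝ) → ℝ} (hu : ContDiff ℝ (⊤ : ℕ∞) u) (hc : HasCompactSupport u)
    {r : ℝ} (hr : 0 < r) (l : List (Fin m)) :
    vfIter Y l (fun w => u (dil σ r w)) = fun x => r ^ l.length * vfIter Y l u (dil σ r x) := by
  induction l with
  | nil => funext x; simp [vfIter]
  | cons i l ih =>
    funext x
    have hs := (vfIter_nice hY hu hc l).1
    have h1 := hY_hom i (vfIter Y l u) hs r hr x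
    have hcd : ContDiff ℝ (⊤ : ℕ∞) (fun w => vfIter Y l u (dil σ r w)) :=
      hs.comp (dil_contDiff σ r)
    have hcd2 : ContDiff ℝ (⊤ : ℕ∞) (fun w => r ^ l.length * vfIter Y l u (dil σ r w)) :=
      contDiff_const.mul hcd
    simp only [vfIter]
    rw [ih, vfDeriv_eq hcd2]
    rw [vfDeriv_eq hcd] at h1
    beta_reduce
    rw [fderiv_const_mul (hcd.differentiable (by simp) x)]
    simp only [ContinuousLinearMap.smul_apply, smul_eq_mul, Real.rpow_one] at h1 ⊢
    rw [h1, List.length_cons, pow_succ]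
    ring

/-- The polynomial under the root in `homNorm`. -/
def homPoly {N : ℕ} (σ : Fin N → ℕ) (x : Fin N → ℝ) : ℝ :=
  ∑ i, |x i| ^ ((2 * Nat.factorial (Finset.univ.sup σ)) / σ i)

lemma exists_exp {N : ℕ} (σ : Fin N → ℕ) (h1 : ∀ i, 1 ≤ σ i) (i : Fin N) :
    ∃ k, 0 < k ∧ (2 * Nat.factorial (Finset.univ.sup σ)) / σ i = 2 * k ∧
      σ i * (2 * k) = 2 * Nat.factorial (Finset.univ.sup σ) := by
  have hd : σ i ∣ Nat.factorial (Finset.univ.sup σ) :=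
    Nat.dvd_factorial (h1 i) (Finset.le_sup (f := σ) (Finset.mem_univ i))
  obtain ⟨k, hk⟩ := hd
  have hp := Nat.factorial_pos (Finset.univ.sup σ)
  refine ⟨k, ?_, ?_, ?_⟩
  · rcases Nat.eq_zero_or_pos k with h | h
    · subst h; omega
    · exact h
  · rw [hk]
    apply Nat.div_eq_of_eq_mul_right (h1 i)
    ring
  · rw [hk]; ring

lemma homPoly_contDiff {N : ℕ} (σ : Fin N → ℕ) (h1 : ∀ i, 1 ≤ σ i) :
    ContDiff ℝ (⊤ : ℕ∞) (homPoly σ) := by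
  unfold homPoly
  refine ContDiff.sum fun i _ => ?_
  obtain ⟨k, -, hk, -⟩ := exists_exp σ h1 i
  have : (fun x : Fin N → ℝ => |x i| ^ ((2 * Nat.factorial (Finset.univ.sup σ)) / σ i))
      = fun x => x i ^ (2 * k) := by
    funext x
    rw [hk, pow_mul, sq_abs, pow_mul]
  rw [this]
  fun_prop

lemma homPoly_nonneg {N : ℕ} (σ : Fin N → ℕ) (x : Fin N → ℝ) : 0 ≤ homPoly σ x :=
  Finset.sum_nonneg fun _ _ => by positivity

lemma homPoly_dil {N : ℕ} (σ : Fin N → ℕ) (h1 : ∀ i, 1 ≤ σ i) {r : ℝ} (hr : 0 < r)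
    (x : Fin N → ℝ) :
    homPoly σ (dil σ r x) = r ^ (2 * Nat.factorial (Finset.univ.sup σ)) * homPoly σ x := by
  unfold homPoly dil
  rw [Finset.mul_sum]
  refine Finset.sum_congr rfl fun i _ => ?_
  obtain ⟨k, -, hk, hk2⟩ := exists_exp σ h1 i
  rw [hk, abs_mul, mul_pow, abs_of_pos (pow_pos hr _), ← pow_mul, hk2]

lemma homNorm_pow {N : ℕ} (σ : Fin N → ℕ) (x : Fin N → ℝ) :
    homNorm σ x ^ (2 * Nat.factorial (Finset.univ.sup σ)) = homPoly σ x := by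
  have h := Real.rpow_inv_natCast_pow (homPoly_nonneg σ x)
    (n := 2 * Nat.factorial (Finset.univ.sup σ)) (by positivity)
  rw [← h]
  unfold homNorm homPoly
  congr 2
  push_cast
  rw [one_div]

lemma homNorm_nonneg {N : ℕ} (σ : Fin N → ℕ) (x : Fin N → ℝ) : 0 ≤ homNorm σ x :=
  Real.rpow_nonneg (homPoly_nonneg σ x) _

/-- One-dimensional profile. -/
def prof (A t : ℝ) : ℝ := Real.smoothTransition ((A - t) / (A - 1))

lemma cutoff_compact {N : ℕ} (σ : Fin N → ℕ) (h1 : ∀ i, 1 ≤ σ i) {A : ℝ} (hA : 1 < A) :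
    HasCompactSupport (fun x => prof A (homPoly σ x)) := by
  refine HasCompactSupport.intro
    (K := Set.pi Set.univ fun _ : Fin N => Set.Icc (-A) A)
    (isCompact_univ_pi fun _ => isCompact_Icc) ?_
  intro x hx
  apply Real.smoothTransition.zero_of_nonpos
  apply div_nonpos_of_nonpos_of_nonneg _ (by linarith)
  by_contra hcon
  push Not at hcon
  apply hx
  intro i _
  refine abs_le.1 ?_
  by_contra hlt
  push Not at hlt
  obtain ⟨k, hk0, hk, -⟩ := exists_exp σ h1 i
  have h2 : |x i| ^ ((2 * Nat.factorial (Finset.univ.sup σ)) / σ i) ≤ homPoly σ x :=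
    Finset.single_le_sum
      (f := fun i => |x i| ^ ((2 * Nat.factorial (Finset.univ.sup σ)) / σ i))
      (fun _ _ => by positivity) (Finset.mem_univ i)
  rw [hk] at h2
  have h3 : |x i| ≤ |x i| ^ (2 * k) := le_self_pow₀ (by linarith) (by omega)
  linarith

/-- **Radial cutoff functions with `R`-uniform derivative bounds** (Lemma 4.7). -/
theorem cutoff_functions_uniform_bounds {N m : ℕ} (hN : 0 < N) (σ : Fin N → ℕ)
    (hσ_mono : Monotone σ) (hσ_ge_one : ∀ i, 1 ≤ σ i)
    (Y : Fin m → (Fin N → ℝ) → (Fin N → ℝ))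
    (hY : ∀ i, ContDiff ℝ (⊤ : ℕ∞) (Y i))
    (hY_hom : ∀ i, IsHomogeneousVF σ (Y i) 1) :
    ∀ h : ℕ, 0 < h → ∃ c > (0:ℝ), ∀ R : ℝ, 1 ≤ R →
      ∃ φ : (Fin N → ℝ) → ℝ,
        ContDiff ℝ (⊤ : ℕ∞) φ ∧
        (∀ x, φ x ∈ Set.Icc (0:ℝ) 1) ∧
        (∃ Ψ : ℝ → ℝ, ∀ x, φ x = Ψ (homNorm σ x)) ∧
        (∀ x, homNorm σ x ≤ R → φ x = 1) ∧
        (∀ x, 2 * R ≤ homNorm σ x → φ x = 0) ∧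
        ∀ l : List (Fin m), l.length ≤ h → ∀ x, |vfIter Y l φ x| ≤ c := by
  intro h _
  have hK : (2 * Nat.factorial (Finset.univ.sup σ)) ≠ 0 := by positivity
  set K := 2 * Nat.factorial (Finset.univ.sup σ) with hKdef
  have hA : (1:ℝ) < 2 ^ K := one_lt_pow₀ (by norm_num) hK
  set u : (Fin N → ℝ) → ℝ := fun x => prof (2 ^ K) (homPoly σ x) with hu
  have hus : ContDiff ℝ (⊤ : ℕ∞) u := by
    have := homPoly_contDiff σ hσ_ge_one
    exact Real.smoothTransition.contDiff.comp ((contDiff_const.sub this).div_const _)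
  have huc : HasCompactSupport u := cutoff_compact σ hσ_ge_one hA
  have hb : ∀ l : List (Fin m), ∃ C, ∀ x, ‖vfIter Y l u x‖ ≤ C := fun l =>
    (vfIter_nice hY hus huc l).1.continuous.bounded_above_of_compact_support
      (vfIter_nice hY hus huc l).2
  choose C hC using hb
  obtain ⟨B, hB⟩ := ((List.finite_length_le (Fin m) h).image C).bddAbove
  refine ⟨max B 1, by positivity, fun R hR => ?_⟩
  have hR0 : 0 < R := by linarith
  have hr : 0 < R⁻¹ := inv_pos.2 hR0
  have key : ∀ x, homPoly σ (dil σ R⁻¹ x) = (homNorm σ x / R) ^ K := by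
    intro x
    rw [homPoly_dil σ hσ_ge_one hr, ← homNorm_pow, ← mul_pow]
    congr 1
    field_simp
  refine ⟨fun x => u (dil σ R⁻¹ x), hus.comp (dil_contDiff σ _), fun x => ?_,
    ⟨fun t => prof (2 ^ K) ((t / R) ^ K), fun x => ?_⟩, fun x hx => ?_, fun x hx => ?_, ?_⟩
  · exact ⟨Real.smoothTransition.nonneg _, Real.smoothTransition.le_one _⟩
  · simp only [hu, key]
  · simp only [hu, key]
    apply Real.smoothTransition.one_of_one_le
    rw [le_div_iff₀ (by linarith)]
    have : (homNorm σ x / R) ^ K ≤ 1 :=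
      pow_le_one₀ (div_nonneg (homNorm_nonneg σ x) hR0.le) ((div_le_one hR0).2 hx)
    linarith
  · simp only [hu, key]
    apply Real.smoothTransition.zero_of_nonpos
    apply div_nonpos_of_nonpos_of_nonneg _ (by linarith)
    have : (2:ℝ) ^ K ≤ (homNorm σ x / R) ^ K :=
      pow_le_pow_left₀ (by norm_num) ((le_div_iff₀ hR0).2 hx) _
    linarith
  · intro l hl x
    rw [vfIter_dil σ hY hY_hom hus huc hr l]
    simp only [abs_mul]
    have h1 : |R⁻¹ ^ l.length| ≤ 1 := by
      rw [abs_of_pos (pow_pos hr _)]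
      exact pow_le_one₀ hr.le (inv_le_one_of_one_le₀ hR)
    have h2 := hC l (dil σ R⁻¹ x)
    rw [Real.norm_eq_abs] at h2
    have h3 : C l ≤ B := hB ⟨l, hl, rfl⟩
    calc _ ≤ 1 * |vfIter Y l u (dil σ R⁻¹ x)| := by gcongr
      _ ≤ max B 1 := by rw [one_mul]; exact (h2.trans h3).trans (le_max_left _ _)

end
end

section
/- (Projection of Hölder regularity from the lifted space.) In the original and lifted settings, there exists a constant c > 0, independent of f, such that: whenever f : ℝ^n → ℝ is continuous and its extension Ef (defined by (Ef)(x,ξ) := f(x)) belongs to C^α_{X̃}(ℝ^N), then f ∈ C^α_X(ℝ^n) and ‖f‖_{C^α_X(ℝ^n)} ≤ c · ‖Ef‖_{C^α_{X̃}(ℝ^N)}. -/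
open MeasureTheory

noncomputable section

variable {E : Type*} [NormedAddCommGroup E] [NormedSpace ℝ E]

/-- The original homogeneous setting together with its global lifting to a Carnot
group on `ℝ^N = ℝ^n × ℝ^p`. -/
structure LiftedSetting (n p m : ℕ) where
  σ : Fin n → ℕ
  τ : Fin p → ℕ
  X : Fin m → (Fin n → ℝ) → (Fin n → ℝ)
  R : Fin m → ((Fin n → ℝ) × (Fin p → ℝ)) → (Fin p → ℝ)
  mul : ((Fin n → ℝ) × (Fin p → ℝ)) → ((Fin n → ℝ) × (Fin p → ℝ)) →
    (Fin n → ℝ) × (Fin p → ℝ)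
  inv : ((Fin n → ℝ) × (Fin p → ℝ)) → (Fin n → ℝ) × (Fin p → ℝ)
  σ_mono : Monotone σ
  σ_ge_one : ∀ i, 1 ≤ σ i
  σ_first : ∀ h : 0 < n, σ ⟨0, h⟩ = 1
  τ_ge_one : ∀ j, 1 ≤ τ j
  X_smooth : ∀ i, ContDiff ℝ (⊤ : ℕ∞) (X i)
  X_indep : LinearIndependent ℝ X
  X_homog : ∀ i, IsHomogeneousVF σ (X i) 1
  hormanderX : HormanderCond X
  q_gt_two : 2 < ∑ i, σ i
  smooth_mul : ContDiff ℝ (⊤ : ℕ∞)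
    (fun q : ((Fin n → ℝ) × (Fin p → ℝ)) × ((Fin n → ℝ) × (Fin p → ℝ)) => mul q.1 q.2)
  smooth_inv : ContDiff ℝ (⊤ : ℕ∞) inv
  mul_assoc' : ∀ x y z, mul (mul x y) z = mul x (mul y z)
  zero_mul' : ∀ x, mul 0 x = x
  mul_zero' : ∀ x, mul x 0 = x
  inv_mul' : ∀ x, mul (inv x) x = 0
  mul_inv' : ∀ x, mul x (inv x) = 0
  dil_auto : ∀ l : ℝ, 0 < l → ∀ x y : (Fin n → ℝ) × (Fin p → ℝ),
    mul (dil σ l x.1, dil τ l x.2) (dil σ l y.1, dil τ l y.2)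
      = (dil σ l (mul x y).1, dil τ l (mul x y).2)
  lift_smooth : ∀ i, ContDiff ℝ (⊤ : ℕ∞)
    (fun q : (Fin n → ℝ) × (Fin p → ℝ) => ((X i q.1, R i q) : (Fin n → ℝ) × (Fin p → ℝ)))
  lift_leftinv : ∀ i, LeftInvariantVF mul (fun q => (X i q.1, R i q))
  lift_homog : ∀ i, ∀ u : ((Fin n → ℝ) × (Fin p → ℝ)) → ℝ, ContDiff ℝ (⊤ : ℕ∞) u →
    ∀ l : ℝ, 0 < l → ∀ q : (Fin n → ℝ) × (Fin p → ℝ),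
      vfDeriv (fun q' => ((X i q'.1, R i q') : (Fin n → ℝ) × (Fin p → ℝ)))
          (fun w => u (dil σ l w.1, dil τ l w.2)) q
        = l * vfDeriv (fun q' => ((X i q'.1, R i q') : (Fin n → ℝ) × (Fin p → ℝ)))
            u (dil σ l q.1, dil τ l q.2)
  hormanderLift : HormanderCond
    (fun i (q : (Fin n → ℝ) × (Fin p → ℝ)) => ((X i q.1, R i q) : (Fin n → ℝ) × (Fin p → ℝ)))

namespace LiftedSetting

variable {n p m : ℕ}

/-- The lifted vector fields `X̃_i`. -/
def Xt (S : LiftedSetting n p m) :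
    Fin m → ((Fin n → ℝ) × (Fin p → ℝ)) → (Fin n → ℝ) × (Fin p → ℝ) :=
  fun i q => (S.X i q.1, S.R i q)

/-- Control distance on `ℝ^n`. -/
def dX (S : LiftedSetting n p m) : (Fin n → ℝ) → (Fin n → ℝ) → ℝ := controlDist S.X

/-- Control distance on the lifted space. -/
def dXt (S : LiftedSetting n p m) :
    ((Fin n → ℝ) × (Fin p → ℝ)) → ((Fin n → ℝ) × (Fin p → ℝ)) → ℝ := controlDist S.Xt

end LiftedSetting

lemma exists_meas_sel {m n : ℕ} (B : ℝ → Fin m → (Fin n → ℝ))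
    (hB : ∀ i, Continuous (fun t => B t i)) (v : ℝ → Fin n → ℝ) (hv : Measurable v) :
    ∃ c : ℝ → EuclideanSpace ℝ (Fin m), Measurable c ∧
      ∀ t, ∀ c0 : EuclideanSpace ℝ (Fin m), ∑ i, c0 i • B t i = v t →
        (∑ i, c t i • B t i = v t ∧ ‖c t‖ ≤ ‖c0‖) := by
  classical
  let G : Set (ℝ × EuclideanSpace ℝ (Fin m)) :=
    {q | ∑ i, q.2 i • B q.1 i = v q.1} ∩ ⋃ k : ℕ, {q | ∀ z : EuclideanSpace ℝ (Fin m),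
      |inner ℝ q.2 z| ≤ k * ‖∑ i, z i • B q.1 i‖}
  have hG : MeasurableSet G := by
    apply MeasurableSet.inter
    · apply measurableSet_eq_fun
      · apply Continuous.measurable
        have := fun i => (hB i).comp (continuous_fst (X := ℝ) (Y := EuclideanSpace ℝ (Fin m)))
        simp only [Function.comp_def] at this
        fun_prop
      · exact hv.comp measurable_fst
    · refine MeasurableSet.iUnion fun k => IsClosed.measurableSet ?_
      simp only [Set.ofPred_forall]
      refine isClosed_iInter fun z => isClosed_le ?_ ?_
      · fun_prop
      · have := fun i => (hB i).comp (continuous_fst (X := ℝ) (Y := EuclideanSpace ℝ (Fin m)))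
        simp only [Function.comp_def] at this
        fun_prop
  have key : ∀ t c c0, (t, c) ∈ G → ∑ i, c0 i • B t i = v t → inner ℝ c (c - c0) = 0 := by
    intro t c c0 hc hc0
    obtain ⟨h1, h2⟩ := hc
    simp only [Set.mem_iUnion, Set.mem_ofPred_eq] at h1 h2
    obtain ⟨k, hk⟩ := h2
    have := hk (c - c0)
    simp only [PiLp.sub_apply, sub_smul, Finset.sum_sub_distrib, h1, hc0, sub_self, norm_zero,
      mul_zero] at this
    exact abs_nonpos_iff.mp this
  have huniq : ∀ t c c', (t, c) ∈ G → (t, c') ∈ G → c = c' := by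
    intro t c c' hc hc'
    have h1 := key t c c' hc hc'.1
    have h2 := key t c' c hc' hc.1
    have : inner ℝ (c - c') (c - c') = 0 := by
      rw [inner_sub_left, h1, ← neg_sub c' c, inner_neg_right, h2]; simp
    rwa [inner_self_eq_zero, sub_eq_zero] at this
  have hex : ∀ (t : ℝ) (c0 : EuclideanSpace ℝ (Fin m)), ∑ i, c0 i • B t i = v t → ∃ c, (t, c) ∈ G := by
    intro t c0 hc0
    let A : EuclideanSpace ℝ (Fin m) →ₗ[ℝ] (Fin n → ℝ) :=
      { toFun := fun z => ∑ i, z i • B t i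
        map_add' := by intro x y; simp [add_smul, Finset.sum_add_distrib]
        map_smul' := by intro r x; simp [mul_smul, Finset.smul_sum] }
    let K := LinearMap.ker A
    have hA : ∀ z, A z = ∑ i, z i • B t i := fun z => rfl
    let c := c0 - K.starProjection c0
    have hcK : c ∈ Kᗮ := K.sub_starProjection_mem_orthogonal c0
    refine ⟨c, ?_, ?_⟩
    · have : A c = A c0 := by
        have h : A (K.starProjection c0) = 0 := K.starProjection_apply_mem c0
        simp only [c, map_sub, h, sub_zero]
      simp only [Set.mem_ofPred_eq]
      rw [← hc0, ← hA, ← hA, this]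
    · have hmem : (innerₛₗ ℝ c : Module.Dual ℝ (EuclideanSpace ℝ (Fin m))) ∈
          LinearMap.range A.dualMap := by
        rw [LinearMap.range_dualMap_eq_dualAnnihilator_ker, Submodule.mem_dualAnnihilator]
        intro w hw
        exact (Submodule.mem_orthogonal' K c).1 hcK w hw
      obtain ⟨g, hg⟩ := hmem
      let g' := LinearMap.toContinuousLinearMap g
      obtain ⟨k, hk⟩ := exists_nat_ge ‖g'‖
      simp only [Set.mem_iUnion, Set.mem_ofPred_eq]
      refine ⟨k, fun z => ?_⟩
      have : inner ℝ c z = g' (A z) := by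
        have := LinearMap.congr_fun hg z
        simpa [g'] using this.symm
      rw [this, ← hA]
      calc |g' (A z)| ≤ ‖g'‖ * ‖A z‖ := g'.le_opNorm _
        _ ≤ _ := by gcongr
  let c : ℝ → EuclideanSpace ℝ (Fin m) := fun t => if h : ∃ c, (t, c) ∈ G then h.choose else 0
  have hcG : ∀ t, (∃ c, (t, c) ∈ G) → (t, c t) ∈ G := by
    intro t h
    simp only [c, dif_pos h]
    exact h.choose_spec
  have himg : ∀ s, MeasurableSet s → MeasurableSet (Prod.fst '' (G ∩ Prod.snd ⁻¹' s)) := by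
    intro s hs
    refine (hG.inter (measurable_snd hs)).image_of_measurable_injOn measurable_fst ?_
    rintro ⟨t, a⟩ ha ⟨t', b⟩ hb h
    simp only at h
    subst h
    rw [huniq t a b ha.1 hb.1]
  refine ⟨c, ?_, ?_⟩
  · intro s hs
    have : c ⁻¹' s = Prod.fst '' (G ∩ Prod.snd ⁻¹' s) ∪
        ((Prod.fst '' (G ∩ Prod.snd ⁻¹' Set.univ))ᶜ ∩ {_t | (0 : EuclideanSpace ℝ (Fin m)) ∈ s}) := by
      ext t
      simp only [Set.mem_preimage, Set.mem_union, Set.mem_image, Set.mem_inter_iff, Prod.exists,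
        Set.mem_compl_iff, Set.mem_ofPred_eq, Set.mem_univ, and_true, exists_and_right,
        exists_eq_right]
      by_cases h : ∃ c, (t, c) ∈ G
      · have h1 := hcG t h
        constructor
        · intro hs
          exact Or.inl ⟨c t, h1, hs⟩
        · rintro (⟨a, ha, has⟩ | ⟨ha, _⟩)
          · rwa [huniq t _ _ h1 ha]
          · exact absurd h ha
      · have h0 : c t = 0 := by simp only [c, dif_neg h]
        rw [h0]
        constructor
        · intro hs
          exact Or.inr ⟨h, hs⟩
        · rintro (⟨a, ha, has⟩ | ⟨_, hs⟩)
          · exact absurd ⟨a, ha⟩ h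
          · exact hs
    rw [this]
    exact (himg s hs).union ((himg _ MeasurableSet.univ).compl.inter (MeasurableSet.const _))
  · intro t c0 hc0
    have h1 := hcG t (hex t c0 hc0)
    refine ⟨h1.1, ?_⟩
    have h2 := key t _ c0 h1 hc0
    rw [inner_sub_right, real_inner_self_eq_norm_sq] at h2
    have h3 := real_inner_le_norm (c t) c0
    by_contra hlt
    push Not at hlt
    have : 0 < ‖c t‖ := lt_of_le_of_lt (norm_nonneg _) hlt
    nlinarith

namespace LiftedSetting

variable {n p m : ℕ}

lemma R_homog (S : LiftedSetting n p m) (i : Fin m) (j : Fin p) (l : ℝ) (hl : 0 < l)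
    (q : (Fin n → ℝ) × (Fin p → ℝ)) :
    l ^ (S.τ j) * S.R i q j = l * S.R i (dil S.σ l q.1, dil S.τ l q.2) j := by
  let L : ((Fin n → ℝ) × (Fin p → ℝ)) →L[ℝ] ℝ :=
    (ContinuousLinearMap.proj j).comp (ContinuousLinearMap.snd ℝ (Fin n → ℝ) (Fin p → ℝ))
  have hline : ∀ (M : ((Fin n → ℝ) × (Fin p → ℝ)) →L[ℝ] ℝ) x v, lineDeriv ℝ (fun w => M w) x v = M v := by
    intro M x v
    rw [M.differentiableAt.lineDeriv_eq_fderiv, M.fderiv]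
  have h := S.lift_homog i (fun w => L w) L.contDiff l hl q
  simp only [vfDeriv] at h
  rw [hline L] at h
  have h2 : (fun w : (Fin n → ℝ) × (Fin p → ℝ) => L (dil S.σ l w.1, dil S.τ l w.2)) =
      fun w => (l ^ (S.τ j) • L) w := by
    funext w
    simp [L, dil]
  rw [h2, hline] at h
  simpa [L] using h

lemma R_cont (S : LiftedSetting n p m) (i : Fin m) : Continuous (S.R i) :=
  continuous_snd.comp (S.lift_smooth i).continuous

lemma R_indep (S : LiftedSetting n p m) (i : Fin m) (j : Fin p) (x : Fin n → ℝ)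
    (ξ η : Fin p → ℝ) (h : ∀ k, S.τ k < S.τ j → ξ k = η k) :
    S.R i (x, ξ) j = S.R i (x, η) j := by
  have hC : ContDiffAt ℝ 1 (fun q => S.R i q j) (0 : (Fin n → ℝ) × (Fin p → ℝ)) := by
    have h1 : ContDiff ℝ 1 (fun q : (Fin n → ℝ) × (Fin p → ℝ) =>
      ((S.X i q.1, S.R i q) : (Fin n → ℝ) × (Fin p → ℝ))) := (S.lift_smooth i).of_le (by
        exact_mod_cast le_top)
    have h2 : ContDiff ℝ 1 (S.R i) := h1.snd
    exact (contDiff_pi.1 h2 j).contDiffAt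
  obtain ⟨K, s, hs, hK⟩ := hC.exists_lipschitzOnWith
  have hdil : ∀ ζ : Fin p → ℝ, Filter.Tendsto (fun l : ℝ =>
      ((dil S.σ l x, dil S.τ l ζ) : (Fin n → ℝ) × (Fin p → ℝ))) (nhdsWithin 0 (Set.Ioi 0)) (nhds 0) := by
    intro ζ
    have hc : Continuous (fun l : ℝ =>
      ((dil S.σ l x, dil S.τ l ζ) : (Fin n → ℝ) × (Fin p → ℝ))) := by
      unfold dil; fun_prop
    have h0 := hc.tendsto 0
    have : ((dil S.σ 0 x, dil S.τ 0 ζ) : (Fin n → ℝ) × (Fin p → ℝ)) = 0 := by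
      ext k
      · have := S.σ_ge_one k
        simp [dil, show S.σ k ≠ 0 by omega]
      · have := S.τ_ge_one k
        simp [dil, show S.τ k ≠ 0 by omega]
    rw [this] at h0
    exact h0.mono_left nhdsWithin_le_nhds
  have hev : ∀ᶠ l in nhdsWithin (0:ℝ) (Set.Ioi 0),
      |S.R i (x, ξ) j - S.R i (x, η) j| ≤ K * (l * ‖ξ - η‖) := by
    filter_upwards [hdil ξ hs, hdil η hs, self_mem_nhdsWithin,
      nhdsWithin_le_nhds (Iio_mem_nhds (zero_lt_one (α := ℝ)))] with l h1 h2 h3 h4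
    simp only [Set.mem_Ioi, Set.mem_Iio] at h3 h4
    have h5 := hK.dist_le_mul _ h1 _ h2
    rw [Real.dist_eq] at h5
    have e1 := S.R_homog i j l h3 (x, ξ)
    have e2 := S.R_homog i j l h3 (x, η)
    simp only at e1 e2
    have hd : dist ((dil S.σ l x, dil S.τ l ξ) : (Fin n → ℝ) × (Fin p → ℝ))
        (dil S.σ l x, dil S.τ l η) ≤ l ^ (S.τ j) * ‖ξ - η‖ := by
      rw [dist_prod_same_left]
      refine (dist_pi_le_iff (by positivity)).2 fun k => ?_
      rw [Real.dist_eq]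
      simp only [dil]
      rw [← mul_sub, abs_mul, abs_of_pos (pow_pos h3 _)]
      by_cases hk : S.τ k < S.τ j
      · rw [h k hk]; simp; positivity
      · have hkn : |ξ k - η k| ≤ ‖ξ - η‖ := norm_le_pi_norm (ξ - η) k
        exact mul_le_mul (pow_le_pow_of_le_one h3.le h4.le (not_lt.1 hk)) hkn (abs_nonneg _)
          (by positivity)
    have h6 : l ^ (S.τ j) * |S.R i (x, ξ) j - S.R i (x, η) j| ≤
        l ^ (S.τ j) * (K * (l * ‖ξ - η‖)) := by
      calc l ^ (S.τ j) * |S.R i (x, ξ) j - S.R i (x, η) j|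
          = l * |S.R i (dil S.σ l x, dil S.τ l ξ) j - S.R i (dil S.σ l x, dil S.τ l η) j| := by
            nth_rewrite 1 [← abs_of_pos (pow_pos h3 (S.τ j))]
            rw [← abs_mul, mul_sub, e1, e2, ← mul_sub, abs_mul, abs_of_pos h3]
        _ ≤ l * (K * (l ^ (S.τ j) * ‖ξ - η‖)) := by
            gcongr
            exact h5.trans (by gcongr)
        _ = _ := by ring
    exact le_of_mul_le_mul_left h6 (pow_pos h3 _)
  have hlim : Filter.Tendsto (fun l : ℝ => K * (l * ‖ξ - η‖)) (nhdsWithin 0 (Set.Ioi 0)) (nhds 0) := by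
    have hc : Continuous (fun l : ℝ => (K:ℝ) * (l * ‖ξ - η‖)) := by fun_prop
    have := hc.tendsto 0
    simp only [zero_mul, mul_zero] at this
    exact this.mono_left nhdsWithin_le_nhds
  have := ge_of_tendsto hlim hev
  exact sub_eq_zero.1 (abs_nonpos_iff.1 this)

/-- Right-hand side of the lifted equation. -/
def rhs (S : LiftedSetting n p m) (γ : ℝ → Fin n → ℝ) (c : ℝ → EuclideanSpace ℝ (Fin m))
    (ξ : ℝ → Fin p → ℝ) (j : Fin p) (r : ℝ) : ℝ := ∑ i, c r i * S.R i (γ r, ξ r) j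

/-- The Picard operator. -/
def picard (S : LiftedSetting n p m) (γ : ℝ → Fin n → ℝ) (c : ℝ → EuclideanSpace ℝ (Fin m))
    (ξ : ℝ → Fin p → ℝ) : ℝ → Fin p → ℝ := fun t j => ∫ r in (0:ℝ)..t, S.rhs γ c ξ j r

lemma rhs_bound (S : LiftedSetting n p m) (γ : ℝ → Fin n → ℝ)
    (c : ℝ → EuclideanSpace ℝ (Fin m)) (M : ℝ) (hM : ∀ t i, |c t i| ≤ M)
    (ξ : ℝ → Fin p → ℝ) (j : Fin p) (r : ℝ) :
    |S.rhs γ c ξ j r| ≤ ∑ i, M * |S.R i (γ r, ξ r) j| := by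
  refine (Finset.abs_sum_le_sum_abs _ _).trans (Finset.sum_le_sum fun i _ => ?_)
  rw [abs_mul]
  exact mul_le_mul_of_nonneg_right (hM r i) (abs_nonneg _)

lemma rhs_bound_cont (S : LiftedSetting n p m) (γ : ℝ → Fin n → ℝ) (hγ : Continuous γ)
    (M : ℝ) (ξ : ℝ → Fin p → ℝ) (hξ : Continuous ξ) (j : Fin p) :
    Continuous fun r => ∑ i, M * |S.R i (γ r, ξ r) j| := by
  have := S.R_cont
  fun_prop

lemma rhs_locInt (S : LiftedSetting n p m) (γ : ℝ → Fin n → ℝ) (hγ : Continuous γ)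
    (c : ℝ → EuclideanSpace ℝ (Fin m)) (hc : Measurable c) (M : ℝ) (hM : ∀ t i, |c t i| ≤ M)
    (ξ : ℝ → Fin p → ℝ) (hξ : Continuous ξ) (j : Fin p) :
    LocallyIntegrable (S.rhs γ c ξ j) volume := by
  refine (S.rhs_bound_cont γ hγ M ξ hξ j).locallyIntegrable.mono ?_ ?_
  · refine Measurable.aestronglyMeasurable ?_
    unfold rhs
    refine Finset.measurable_fun_sum _ fun i _ => Measurable.mul ?_ ?_
    · fun_prop
    · have := S.R_cont i
      apply Continuous.measurable
      fun_prop
  · refine Filter.Eventually.of_forall fun r => ?_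
    rw [Real.norm_eq_abs, Real.norm_eq_abs]
    exact (S.rhs_bound γ c M hM ξ j r).trans (le_abs_self _)

lemma picard_cont (S : LiftedSetting n p m) (γ : ℝ → Fin n → ℝ) (hγ : Continuous γ)
    (c : ℝ → EuclideanSpace ℝ (Fin m)) (hc : Measurable c) (M : ℝ) (hM : ∀ t i, |c t i| ≤ M)
    (ξ : ℝ → Fin p → ℝ) (hξ : Continuous ξ) : Continuous (S.picard γ c ξ) := by
  refine continuous_pi fun j => ?_
  have h := S.rhs_locInt γ hγ c hc M hM ξ hξ j
  exact intervalIntegral.continuous_primitive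
    (fun a b => (h.integrableOn_isCompact isCompact_uIcc).intervalIntegrable) 0

lemma exists_lift (S : LiftedSetting n p m) (γ : ℝ → Fin n → ℝ) (hγ : Continuous γ)
    (c : ℝ → EuclideanSpace ℝ (Fin m)) (hc : Measurable c) (M : ℝ) (hM : ∀ t i, |c t i| ≤ M) :
    ∃ ξ : ℝ → Fin p → ℝ, Continuous ξ ∧ S.picard γ c ξ = ξ := by
  let Φ := S.picard γ c
  have hcont : ∀ s : ℕ, Continuous (Φ^[s] 0) := by
    intro s
    induction s with
    | zero => exact continuous_zero
    | succ s ih =>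
      rw [Function.iterate_succ_apply']
      exact S.picard_cont γ hγ c hc M hM _ ih
  have hstab : ∀ s : ℕ, ∀ j, S.τ j ≤ s → ∀ t, (Φ^[s+1] 0) t j = (Φ^[s] 0) t j := by
    intro s
    induction s with
    | zero =>
      intro j hj
      have := S.τ_ge_one j
      omega
    | succ s ih =>
      intro j hj t
      rw [Function.iterate_succ_apply' Φ (s + 1)]
      refine Eq.trans ?_ (congrFun (congrFun (Function.iterate_succ_apply' Φ s 0).symm t) j)
      change (∫ r in (0:ℝ)..t, S.rhs γ c (Φ^[s + 1] 0) j r) =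
        ∫ r in (0:ℝ)..t, S.rhs γ c (Φ^[s] 0) j r
      congr 1
      funext r
      simp only [rhs]
      refine Finset.sum_congr rfl fun i _ => ?_
      rw [S.R_indep i j (γ r) _ _ fun k hk => ih k (by omega) r]
  refine ⟨Φ^[Finset.univ.sup S.τ] 0, hcont _, ?_⟩
  funext t j
  have := hstab (Finset.univ.sup S.τ) j (Finset.le_sup (Finset.mem_univ j)) t
  rw [Function.iterate_succ_apply'] at this
  exact this

/-- Every admissible curve lifts to a curve whose controls are larger by a factor `m + 1` at most. -/
lemma lift_curve (S : LiftedSetting n p m) (x y : Fin n → ℝ) (δ : ℝ) (hδ : 0 < δ)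
    (γ0 : ℝ → Fin n → ℝ) (c0 : Fin m → ℝ → ℝ) (K : NNReal)
    (hK : LipschitzOnWith K γ0 (Set.Icc 0 1)) (h0 : γ0 0 = x) (h1 : γ0 1 = y)
    (hd : ∀ᵐ t ∂(volume.restrict (Set.Ioo (0:ℝ) 1)),
      HasDerivAt γ0 (∑ i, c0 i t • S.X i (γ0 t)) t)
    (hc0 : ∀ i, ∀ t ∈ Set.Icc (0:ℝ) 1, |c0 i t| < δ) :
    ∃ η, S.dXt (x, 0) (y, η) ≤ (m + 1) * δ := by
  classical
  let γ : ℝ → Fin n → ℝ := fun t => γ0 (Set.projIcc 0 1 zero_le_one t)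
  have hγ : Continuous γ := hK.continuousOn.comp_continuous (by fun_prop) fun t => Subtype.coe_prop _
  have hγeq : ∀ t ∈ Set.Icc (0:ℝ) 1, γ t = γ0 t := by
    intro t ht
    simp only [γ, Set.projIcc_of_mem _ ht]
  have hKγ : LipschitzOnWith K γ (Set.Icc 0 1) := by
    intro a ha b hb
    rw [hγeq a ha, hγeq b hb]
    exact hK ha hb
  obtain ⟨c1, hc1m, hc1⟩ := exists_meas_sel (fun t i => S.X i (γ t))
    (fun i => (S.X_smooth i).continuous.comp hγ) (deriv γ) (measurable_deriv γ)
  let D : ℝ := (m + 1) * δ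
  have hD : 0 < D := by positivity
  let c : ℝ → EuclideanSpace ℝ (Fin m) := fun t => if ‖c1 t‖ < D then c1 t else 0
  have hcm : Measurable c :=
    Measurable.ite (measurableSet_lt hc1m.norm measurable_const) hc1m measurable_const
  have hcn : ∀ t, ‖c t‖ < D := by
    intro t
    simp only [c]
    split_ifs with h
    · exact h
    · simpa using hD
  have hcb : ∀ t i, |c t i| < D := fun t i => (PiLp.norm_apply_le (c t) i).trans_lt (hcn t)
  obtain ⟨ξ, hξ, hfix⟩ := S.exists_lift γ hγ c hcm D (fun t i => (hcb t i).le)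
  have hloc := S.rhs_locInt γ hγ c hcm D (fun t i => (hcb t i).le) ξ hξ
  have hξt : ∀ t j, ξ t j = ∫ r in (0:ℝ)..t, S.rhs γ c ξ j r := by
    intro t j
    nth_rewrite 1 [← hfix]
    rfl
  -- Lipschitz bound for the lifted part
  have hLip : ∃ K' : NNReal, LipschitzOnWith K' ξ (Set.Icc 0 1) := by
    have hb : ∃ C : ℝ, ∀ r ∈ Set.Icc (0:ℝ) 1, (∑ j, ∑ i, D * |S.R i (γ r, ξ r) j|) ≤ C := by
      have := isCompact_Icc (a := (0:ℝ)) (b := 1) |>.bddAbove_image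
        (continuous_finsetSum Finset.univ
          fun j _ => S.rhs_bound_cont γ hγ D ξ hξ j).continuousOn
      obtain ⟨C, hC⟩ := this
      exact ⟨C, fun r hr => hC (Set.mem_image_of_mem _ hr)⟩
    obtain ⟨C, hC⟩ := hb
    refine ⟨C.toNNReal, LipschitzOnWith.of_dist_le_mul fun a ha b hb => ?_⟩
    refine (dist_pi_le_iff (by positivity)).2 fun j => ?_
    rw [hξt, hξt, Real.dist_eq]
    have hii : ∀ a b, IntervalIntegrable (S.rhs γ c ξ j) volume a b := fun a b =>
      ((hloc j).integrableOn_isCompact isCompact_uIcc).intervalIntegrable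
    rw [intervalIntegral.integral_interval_sub_left (hii _ _) (hii _ _)]
    have := intervalIntegral.norm_integral_le_of_norm_le_const (a := b) (b := a) (C := C)
      (f := S.rhs γ c ξ j) (by
        intro r hr
        have hr' : r ∈ Set.Icc (0:ℝ) 1 :=
          Set.uIcc_subset_Icc hb ha (Set.uIoc_subset_uIcc hr)
        refine (S.rhs_bound γ c D (fun t i => (hcb t i).le) ξ j r).trans
          (le_trans ?_ (hC r hr'))
        exact Finset.single_le_sum (f := fun j => ∑ i, D * |S.R i (γ r, ξ r) j|)
          (fun j _ => by positivity) (Finset.mem_univ j))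
    rw [Real.norm_eq_abs] at this
    refine this.trans ?_
    rw [Real.dist_eq]
    exact mul_le_mul_of_nonneg_right (Real.le_coe_toNNReal C) (abs_nonneg _)
  obtain ⟨K', hK'⟩ := hLip
  refine ⟨ξ 1, csInf_le ⟨0, fun r hr => hr.1.le⟩ ⟨hD, fun t => (γ t, ξ t), fun i t => c t i,
    max K K', hKγ.prodMk hK', ?_, ?_, ?_, fun i t _ => hcb t i⟩⟩
  · ext j
    · simp only [hγeq 0 (by simp), h0]
    · simp [hξt]
  · simp only [hγeq 1 (by simp), h1]
  · have hae : ∀ᵐ t ∂(volume.restrict (Set.Ioo (0:ℝ) 1)), ∀ j,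
        HasDerivAt (fun t => ξ t j) (S.rhs γ c ξ j t) t := by
      refine ae_restrict_of_ae (ae_all_iff.2 fun j => ?_)
      filter_upwards [_root_.LocallyIntegrable.ae_hasDerivAt_integral (hloc j)] with t ht
      have := ht 0
      simp_rw [← hξt] at this
      exact this
    filter_upwards [hae, hd, ae_restrict_mem measurableSet_Ioo] with t ht1 ht2 ht3
    have htI : t ∈ Set.Icc (0:ℝ) 1 := Set.Ioo_subset_Icc_self ht3
    have hder : HasDerivAt γ (∑ i, c0 i t • S.X i (γ0 t)) t := by
      refine ht2.congr_of_eventuallyEq ?_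
      filter_upwards [Ioo_mem_nhds ht3.1 ht3.2] with s hs
      exact hγeq s (Set.Ioo_subset_Icc_self hs)
    obtain ⟨e1, e2⟩ := hc1 t (WithLp.toLp 2 fun i => c0 i t) (by
      simp only [hγeq t htI]
      exact hder.deriv.symm)
    have hnorm : ‖c1 t‖ < D := by
      refine e2.trans_lt ?_
      have : ‖(WithLp.toLp 2 fun i => c0 i t : EuclideanSpace ℝ (Fin m))‖ ≤ ∑ i : Fin m, |c0 i t| := by
        rw [EuclideanSpace.norm_eq]
        refine Real.sqrt_le_iff.2 ⟨by positivity, ?_⟩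
        simp only [Real.norm_eq_abs]
        exact Finset.sum_sq_le_sq_sum_of_nonneg (fun i _ => abs_nonneg _)
      refine this.trans_lt ?_
      calc ∑ i : Fin m, |c0 i t| ≤ ∑ i : Fin m, δ := Finset.sum_le_sum fun i _ => (hc0 i t htI).le
        _ = m * δ := by simp
        _ < D := by simp only [D]; linarith
    have hct : c t = c1 t := by simp only [c, if_pos hnorm]
    have hγd : HasDerivAt γ (∑ i, c t i • S.X i (γ t)) t := by
      rw [hct, e1]
      exact hder.differentiableAt.hasDerivAt
    have hξd : HasDerivAt ξ (∑ i, c t i • S.R i (γ t, ξ t)) t := by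
      refine hasDerivAt_pi.2 fun j => ?_
      have := ht1 j
      simpa [rhs] using this
    have hpair := hγd.prodMk hξd
    have hsum : ∑ i, (c t).ofLp i • S.Xt i (γ t, ξ t) =
        (∑ i, (c t).ofLp i • S.X i (γ t), ∑ i, (c t).ofLp i • S.R i (γ t, ξ t)) := by
      apply Prod.ext
      · rw [Prod.fst_sum]; rfl
      · rw [Prod.snd_sum]; rfl
    rw [hsum]
    exact hpair

end LiftedSetting

/-- **Projection of Hölder regularity from the lifted space** (Lemma 5.2):
if the extension `Ef(x,ξ) = f(x)` is in `C^α_{X̃}(ℝ^N)`, then `f ∈ C^α_X(ℝ^n)`,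
with a norm estimate uniform in `f`. -/
theorem holder_projection_from_lifting {n p m : ℕ} (hp : 0 < p)
    (S : LiftedSetting n p m) (α : ℝ) (hα : α ∈ Set.Ioo (0:ℝ) 1) :
    ∃ c > (0:ℝ), ∀ f : (Fin n → ℝ) → ℝ, Continuous f →
      MemCalpha S.dXt α Set.univ (fun q => f q.1) →
      MemCalpha S.dX α Set.univ f ∧
      holderNorm S.dX α Set.univ f ≤
        c * holderNorm S.dXt α Set.univ (fun q => f q.1) := by
  have hm : (0:ℝ) < (m:ℝ) + 1 := by positivity
  have hm1 : (1:ℝ) ≤ (m:ℝ) + 1 := by linarith [Nat.cast_nonneg (α := ℝ) m]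
  have hα0 : 0 < α := hα.1
  refine ⟨(m:ℝ) + 1, hm, fun f _ hf => ?_⟩
  have hsup : ∀ C, supBoundOn Set.univ (fun q : (Fin n → ℝ) × (Fin p → ℝ) => f q.1) C ↔
      supBoundOn Set.univ f C := by
    intro C
    constructor
    · intro h x _
      exact h (x, 0) (Set.mem_univ _)
    · intro h q _
      exact h q.1 (Set.mem_univ _)
  have hhol : ∀ C, 0 ≤ C → holderBoundOn S.dXt α Set.univ (fun q => f q.1) C →
      holderBoundOn S.dX α Set.univ f (((m:ℝ) + 1) * C) := by
    intro C hC h x _ y _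
    have hnn : ∀ a b, 0 ≤ S.dXt a b := fun a b => Real.sInf_nonneg fun r hr => hr.1.le
    rcases Set.eq_empty_or_nonempty {δ : ℝ | 0 < δ ∧ ∃ γ : ℝ → (Fin n → ℝ),
      ∃ c : Fin m → ℝ → ℝ, ∃ K : NNReal,
      LipschitzOnWith K γ (Set.Icc 0 1) ∧ γ 0 = x ∧ γ 1 = y ∧
      (∀ᵐ t ∂(volume.restrict (Set.Ioo (0:ℝ) 1)),
        HasDerivAt γ (∑ i, c i t • S.X i (γ t)) t) ∧
      (∀ i, ∀ t ∈ Set.Icc (0:ℝ) 1, |c i t| < δ)} with he | hne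
    · have h0 : S.dXt (x, 0) (y, 0) = 0 := by
        unfold LiftedSetting.dXt controlDist
        convert Real.sInf_empty
        rw [Set.eq_empty_iff_forall_notMem] at he ⊢
        rintro δ ⟨hδ, γ, c, K, h1, h2, h3, h4, h5⟩
        refine he δ ⟨hδ, fun t => (γ t).1, c, K, ?_, by simp [h2], by simp [h3], ?_, h5⟩
        · have := LipschitzWith.prod_fst (α := Fin n → ℝ) (β := Fin p → ℝ)
            |>.comp_lipschitzOnWith h1
          rw [one_mul] at this
          exact this
        · filter_upwards [h4] with t ht
          have h6 : HasDerivAt (fun t => (γ t).1) (∑ i, c i t • S.Xt i (γ t)).1 t :=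
            (ContinuousLinearMap.fst ℝ (Fin n → ℝ) (Fin p → ℝ)).hasFDerivAt.comp_hasDerivAt t ht
          rw [Prod.fst_sum] at h6
          exact h6
      have h1 := h (x, 0) (Set.mem_univ _) (y, 0) (Set.mem_univ _)
      rw [h0, Real.zero_rpow hα0.ne', mul_zero] at h1
      refine h1.trans ?_
      have : 0 ≤ S.dX x y := Real.sInf_nonneg fun r hr => hr.1.le
      positivity
    · obtain ⟨u, -, hu, hmem⟩ := exists_seq_tendsto_sInf hne ⟨0, fun r hr => hr.1.le⟩
      have hle : ∀ k, |f x - f y| ≤ ((m:ℝ) + 1) * C * u k ^ α := by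
        intro k
        obtain ⟨hδ, γ, c, K, h1, h2, h3, h4, h5⟩ := hmem k
        obtain ⟨η, hη⟩ := S.lift_curve x y (u k) hδ γ c K h1 h2 h3 h4 h5
        have h6 := h (x, 0) (Set.mem_univ _) (y, η) (Set.mem_univ _)
        refine h6.trans ?_
        have h7 : S.dXt (x, 0) (y, η) ^ α ≤ ((m:ℝ) + 1) * u k ^ α := by
          calc S.dXt (x, 0) (y, η) ^ α ≤ (((m:ℝ) + 1) * u k) ^ α :=
                Real.rpow_le_rpow (hnn _ _) hη hα0.le
            _ = ((m:ℝ) + 1) ^ α * u k ^ α := Real.mul_rpow hm.le hδ.le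
            _ ≤ ((m:ℝ) + 1) * u k ^ α := by
                refine mul_le_mul_of_nonneg_right ?_ (Real.rpow_nonneg hδ.le _)
                calc ((m:ℝ) + 1) ^ α ≤ ((m:ℝ) + 1) ^ (1:ℝ) :=
                      Real.rpow_le_rpow_of_exponent_le hm1 hα.2.le
                  _ = _ := Real.rpow_one _
        calc C * S.dXt (x, 0) (y, η) ^ α ≤ C * (((m:ℝ) + 1) * u k ^ α) := by gcongr
          _ = _ := by ring
      have hlim := (hu.rpow_const (Or.inr hα0.le) : Filter.Tendsto (fun k => u k ^ α) _ _).const_mul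
        (((m:ℝ) + 1) * C)
      exact ge_of_tendsto' hlim hle
  obtain ⟨⟨C1, hC1, hC1'⟩, C2, hC2, hC2'⟩ := hf
  refine ⟨⟨⟨C1, hC1, (hsup C1).1 hC1'⟩, ((m:ℝ) + 1) * C2, by positivity, hhol C2 hC2 hC2'⟩, ?_⟩
  have e1 : supNormOn Set.univ (fun q : (Fin n → ℝ) × (Fin p → ℝ) => f q.1) =
      supNormOn Set.univ f := by
    simp only [supNormOn, hsup]
  have e2 : holderSemi S.dX α Set.univ f ≤
      ((m:ℝ) + 1) * holderSemi S.dXt α Set.univ (fun q => f q.1) := by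
    rw [← div_le_iff₀' hm]
    refine le_csInf ⟨C2, hC2, hC2'⟩ fun C hC => ?_
    rw [div_le_iff₀' hm]
    exact csInf_le ⟨0, fun r hr => hr.1⟩ ⟨by have := hC.1; positivity, hhol C hC.1 hC.2⟩
  have e3 : 0 ≤ supNormOn Set.univ f := Real.sInf_nonneg fun r hr => hr.1
  unfold holderNorm
  rw [e1, mul_add]
  nlinarith

end
end
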